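/- Let φ : [0,∞) → ℝ and ψ : ℝ³ → ℝ be nonnegative, smooth, compactly supported functions such that φ ≡ 1 on [1,2] and ψ is not identically zero. Then ∫₀^∞ ∫_{ℝ³} φ(t)·ψ(x)·c_n(t,x) dx dt → ∞ as n → ∞, where c_n = 3·c¹_n − 9·c²_n is the renormalization function. -/

import Mathlib

open MeasureTheory Real

noncomputable section

/-- Mehler heat kernel of the harmonic oscillator `H = -Δ + |x|²` on `ℝ³`. -/
def mehlerK (t : ℝ) (x y : EuclideanSpace ℝ (Fin 3)) : ℝ :=
  (2 * π * Real.sinh (2 * t)) ^ (-(3 : ℝ) / 2) *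
    Real.exp (-‖x - y‖ ^ 2 / (4 * Real.tanh t) - Real.tanh t * ‖x + y‖ ^ 2 / 4)

/-- The regularized covariance `𝒞⁽ⁿ⁾_{t₁,t₂}(y₁,y₂)`, with `ε_n = 2^{-n}`. -/
def covC (n : ℕ) (t₁ t₂ : ℝ) (y₁ y₂ : EuclideanSpace ℝ (Fin 3)) : ℝ :=
  (1 / 2) * ∫ σ in (|t₂ - t₁| + 2 * (2 : ℝ) ^ (-(n : ℝ)))..(t₁ + t₂ + 2 * (2 : ℝ) ^ (-(n : ℝ))),
    mehlerK σ y₁ y₂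

/-- First renormalization function `c¹_n(t,x) = ∫_{2^{-n}}^{t+2^{-n}} K_{2σ}(x,x) dσ`. -/
def c1 (n : ℕ) (t : ℝ) (x : EuclideanSpace ℝ (Fin 3)) : ℝ :=
  ∫ σ in ((2 : ℝ) ^ (-(n : ℝ)))..(t + (2 : ℝ) ^ (-(n : ℝ))), mehlerK (2 * σ) x x

/-- Second renormalization function
`c²_n(t,x) = 2 ∫₀^t ∫ K_{t-s}(x,w) 𝒞⁽ⁿ⁾_{t,s}(x,w)² dw ds`. -/
def c2 (n : ℕ) (t : ℝ) (x : EuclideanSpace ℝ (Fin 3)) : ℝ :=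
  2 * ∫ s in (0 : ℝ)..t, ∫ w, mehlerK (t - s) x w * covC n t s x w ^ 2

/-- The renormalization function `c_n = 3 c¹_n - 9 c²_n`. -/
def cRen (n : ℕ) (t : ℝ) (x : EuclideanSpace ℝ (Fin 3)) : ℝ :=
  3 * c1 n t x - 9 * c2 n t x

/-- A parametrised interval integral with measurable endpoints is measurable. -/
lemma measurable_intervalIntegral_param {X : Type*} [MeasurableSpace X] {f : X → ℝ → ℝ}
    {a b : X → ℝ} (hf : Measurable (Function.uncurry f)) (ha : Measurable a) (hb : Measurable b) :
    Measurable fun x => ∫ s in a x..b x, f x s := by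
  have key : ∀ {u v : X → ℝ}, Measurable u → Measurable v →
      Measurable fun x => ∫ s in Set.Ioc (u x) (v x), f x s := by
    intro u v hu hv
    have hS : MeasurableSet {p : X × ℝ | u p.1 < p.2 ∧ p.2 ≤ v p.1} :=
      (measurableSet_lt (hu.comp measurable_fst) measurable_snd).inter
        (measurableSet_le measurable_snd (hv.comp measurable_fst))
    have h := (hf.indicator hS).stronglyMeasurable.integral_prod_right' (ν := (volume : Measure ℝ))
    convert h.measurable using 2 with x
    rw [← integral_indicator measurableSet_Ioc]
    rfl
  exact (key ha hb).sub (key hb ha)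

lemma tanh_nonneg_of_nonneg {t : ℝ} (ht : 0 ≤ t) : 0 ≤ Real.tanh t := by
  rw [Real.tanh_eq_sinh_div_cosh]
  exact div_nonneg (Real.sinh_nonneg_iff.2 ht) (Real.cosh_pos t).le

lemma sinh_le_mul_exp (u : ℝ) : Real.sinh u ≤ u * Real.exp u := by
  have h := Real.add_one_le_exp (-2 * u)
  have h2 : Real.exp (-u) = Real.exp u * Real.exp (-2 * u) := by
    rw [← Real.exp_add]; ring_nf
  rw [Real.sinh_eq, h2]
  nlinarith [Real.exp_pos u]

lemma measurable_mehlerK {X : Type*} [MeasurableSpace X] {t : X → ℝ}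
    {x y : X → EuclideanSpace ℝ (Fin 3)} (ht : Measurable t) (hx : Measurable x)
    (hy : Measurable y) : Measurable fun p => mehlerK (t p) (x p) (y p) := by
  unfold mehlerK
  simp only [Real.tanh_eq_sinh_div_cosh]
  fun_prop

lemma measurable_covC {X : Type*} [MeasurableSpace X] (n : ℕ) {s t : X → ℝ}
    {x y : X → EuclideanSpace ℝ (Fin 3)} (hs : Measurable s) (ht : Measurable t)
    (hx : Measurable x) (hy : Measurable y) :
    Measurable fun p => covC n (s p) (t p) (x p) (y p) := by
  unfold covC
  refine (measurable_intervalIntegral_param ?_ ?_ ?_).const_mul _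
  · exact measurable_mehlerK measurable_snd (hx.comp measurable_fst) (hy.comp measurable_fst)
  · simp only [← Real.norm_eq_abs]
    fun_prop
  · fun_prop

lemma measurable_c1 (n : ℕ) :
    Measurable fun p : ℝ × EuclideanSpace ℝ (Fin 3) => c1 n p.1 p.2 := by
  unfold c1
  refine measurable_intervalIntegral_param ?_ (by fun_prop) (by fun_prop)
  exact measurable_mehlerK (by fun_prop) (by fun_prop) (by fun_prop)

lemma measurable_c2 (n : ℕ) :
    Measurable fun p : ℝ × EuclideanSpace ℝ (Fin 3) => c2 n p.1 p.2 := by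
  unfold c2
  refine (measurable_intervalIntegral_param ?_ (by fun_prop) (by fun_prop)).const_mul _
  have h : Measurable fun q : ((ℝ × EuclideanSpace ℝ (Fin 3)) × ℝ) × EuclideanSpace ℝ (Fin 3) =>
      mehlerK (q.1.1.1 - q.1.2) q.1.1.2 q.2 * covC n q.1.1.1 q.1.2 q.1.1.2 q.2 ^ 2 :=
    (measurable_mehlerK (by fun_prop) (by fun_prop) (by fun_prop)).mul
      ((measurable_covC n (by fun_prop) (by fun_prop) (by fun_prop) (by fun_prop)).pow_const 2)
  exact (h.stronglyMeasurable.integral_prod_right'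
    (ν := (volume : Measure (EuclideanSpace ℝ (Fin 3))))).measurable

lemma measurable_cRen (n : ℕ) :
    Measurable fun p : ℝ × EuclideanSpace ℝ (Fin 3) => cRen n p.1 p.2 := by
  unfold cRen
  exact ((measurable_c1 n).const_mul 3).sub ((measurable_c2 n).const_mul 9)

lemma mehlerK_nonneg {t : ℝ} (ht : 0 ≤ t) (x y : EuclideanSpace ℝ (Fin 3)) :
    0 ≤ mehlerK t x y := by
  have : 0 ≤ Real.sinh (2 * t) := Real.sinh_nonneg_iff.2 (by linarith)
  unfold mehlerK
  positivity

lemma mehlerK_le_rpow {t : ℝ} (ht : 0 < t) (x y : EuclideanSpace ℝ (Fin 3)) :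
    mehlerK t x y ≤ t ^ (-(3 : ℝ) / 2) := by
  have h1 : 2 * t ≤ Real.sinh (2 * t) := Real.self_le_sinh_iff.2 (by linarith)
  have h2 : t ≤ 2 * π * Real.sinh (2 * t) := by nlinarith [Real.pi_gt_three]
  have h3 : (2 * π * Real.sinh (2 * t)) ^ (-(3 : ℝ) / 2) ≤ t ^ (-(3 : ℝ) / 2) :=
    Real.rpow_le_rpow_of_nonpos ht h2 (by norm_num)
  have hth := tanh_nonneg_of_nonneg ht.le
  have h4 : Real.exp (-‖x - y‖ ^ 2 / (4 * Real.tanh t) - Real.tanh t * ‖x + y‖ ^ 2 / 4) ≤ 1 := by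
    rw [Real.exp_le_one_iff, neg_div]
    have : 0 ≤ ‖x - y‖ ^ 2 / (4 * Real.tanh t) := by positivity
    have : 0 ≤ Real.tanh t * ‖x + y‖ ^ 2 / 4 := by positivity
    linarith
  calc mehlerK t x y ≤ t ^ (-(3 : ℝ) / 2) * 1 := by
        unfold mehlerK
        exact mul_le_mul h3 h4 (Real.exp_pos _).le (by positivity)
    _ = _ := mul_one _

/-- The Mehler kernel is dominated by an integrable Gaussian of total mass at most one. -/
lemma exists_gaussian_bound {t : ℝ} (ht : 0 < t) (x : EuclideanSpace ℝ (Fin 3)) :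
    ∃ g : EuclideanSpace ℝ (Fin 3) → ℝ, Integrable g ∧ (∀ w, mehlerK t x w ≤ g w) ∧
      ∫ w, g w ≤ 1 := by
  set A : ℝ := (2 * π * Real.sinh (2 * t)) ^ (-(3 : ℝ) / 2) with hA
  have hs : 0 < Real.sinh t := Real.sinh_pos_iff.2 ht
  have hc : 1 ≤ Real.cosh t := Real.one_le_cosh t
  have hth : 0 < Real.tanh t := by
    rw [Real.tanh_eq_sinh_div_cosh]; positivity
  set b : ℝ := (4 * Real.tanh t)⁻¹ with hb
  have hb0 : 0 < b := by positivity
  have hA0 : 0 ≤ A := by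
    rw [hA, Real.sinh_two_mul]; positivity
  have hint : ∫ w : EuclideanSpace ℝ (Fin 3), Real.exp (-b * ‖w‖ ^ 2) = (π / b) ^ ((3 : ℝ) / 2) := by
    rw [GaussianFourier.integral_rexp_neg_mul_sq_norm hb0]
    simp
  have hi0 : Integrable fun w : EuclideanSpace ℝ (Fin 3) => Real.exp (-b * ‖w‖ ^ 2) := by
    refine Integrable.of_integral_ne_zero ?_
    rw [hint]
    positivity
  refine ⟨fun w => A * Real.exp (-b * ‖x - w‖ ^ 2), ?_, ?_, ?_⟩
  · exact (hi0.comp_sub_left x).const_mul A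
  · intro w
    unfold mehlerK
    refine mul_le_mul_of_nonneg_left (Real.exp_le_exp.2 ?_) hA0
    have h : -‖x - w‖ ^ 2 / (4 * Real.tanh t) = -b * ‖x - w‖ ^ 2 := by
      rw [hb]; ring
    have : 0 ≤ Real.tanh t * ‖x + w‖ ^ 2 / 4 := by positivity
    rw [h]; linarith
  · rw [integral_const_mul,
      integral_sub_left_eq_self (fun w : EuclideanSpace ℝ (Fin 3) => Real.exp (-b * ‖w‖ ^ 2)),
      hint, hA, neg_div, Real.rpow_neg (by rw [Real.sinh_two_mul]; positivity), inv_mul_le_one₀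
        (by rw [Real.sinh_two_mul]; positivity)]
    refine Real.rpow_le_rpow (by positivity) ?_ (by norm_num)
    rw [hb, div_inv_eq_mul, Real.sinh_two_mul, Real.tanh_eq_sinh_div_cosh]
    have : Real.sinh t / Real.cosh t ≤ Real.sinh t * Real.cosh t :=
      (div_le_self hs.le hc).trans (le_mul_of_one_le_right hs.le hc)
    nlinarith [Real.pi_pos]

lemma abs_covC_le (n : ℕ) {t s : ℝ} (hs : 0 ≤ s) (hst : s ≤ t) (x w : EuclideanSpace ℝ (Fin 3)) :
    |covC n t s x w| ≤ (t - s + 2 * (2 : ℝ) ^ (-(n : ℝ))) ^ (-(1 : ℝ) / 2) := by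
  unfold covC
  have he : 0 < (2 : ℝ) ^ (-(n : ℝ)) := by positivity
  set e := (2 : ℝ) ^ (-(n : ℝ))
  have habs : |s - t| = t - s := by rw [abs_of_nonpos (by linarith)]; ring
  rw [habs]
  set a := t - s + 2 * e with ha
  set b := t + s + 2 * e with hb
  have ha0 : 0 < a := by linarith
  have hab : a ≤ b := by linarith
  have h0 : (0 : ℝ) ∉ Set.uIcc a b := by
    rw [Set.uIcc_of_le hab]; intro h; linarith [h.1]
  have hI : ‖∫ σ in a..b, mehlerK σ x w‖ ≤ ∫ σ in a..b, σ ^ (-(3 : ℝ) / 2) := by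
    refine intervalIntegral.norm_integral_le_of_norm_le hab (Filter.Eventually.of_forall ?_)
      (intervalIntegral.intervalIntegrable_rpow (Or.inr h0))
    intro σ hσ
    have hσ0 : 0 < σ := ha0.trans hσ.1
    rw [Real.norm_of_nonneg (mehlerK_nonneg hσ0.le x w)]
    exact mehlerK_le_rpow hσ0 x w
  rw [integral_rpow (Or.inr ⟨by norm_num, h0⟩)] at hI
  have hbp : 0 ≤ b ^ (-(3 : ℝ) / 2 + 1) := Real.rpow_nonneg (by linarith) _
  have he : -(3 : ℝ) / 2 + 1 = -(1 : ℝ) / 2 := by norm_num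
  rw [he] at hI hbp
  rw [abs_mul, abs_of_pos (by norm_num : (0 : ℝ) < 1 / 2), ← Real.norm_eq_abs]
  linarith

lemma abs_c2_le (n : ℕ) {t : ℝ} (ht : 0 ≤ t) (x : EuclideanSpace ℝ (Fin 3)) :
    |c2 n t x| ≤ 2 * Real.log ((t + 2 * (2 : ℝ) ^ (-(n : ℝ))) / (2 * (2 : ℝ) ^ (-(n : ℝ)))) := by
  have he : 0 < (2 : ℝ) ^ (-(n : ℝ)) := by positivity
  unfold c2
  set e := (2 : ℝ) ^ (-(n : ℝ)) with hedef
  have hlog : ∫ s in (0 : ℝ)..t, (t + 2 * e - s)⁻¹ = Real.log ((t + 2 * e) / (2 * e)) := by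
    rw [intervalIntegral.integral_comp_sub_left (fun u => u⁻¹) (t + 2 * e),
      integral_inv_of_pos (by linarith) (by linarith)]
    congr 2 <;> ring
  rw [abs_mul, abs_of_pos (by norm_num : (0 : ℝ) < 2), ← hlog]
  refine mul_le_mul_of_nonneg_left ?_ (by norm_num)
  rw [← Real.norm_eq_abs]
  have hbi : IntervalIntegrable (fun s => (t + 2 * e - s)⁻¹) volume 0 t := by
    refine ContinuousOn.intervalIntegrable ?_
    refine ContinuousOn.inv₀ (by fun_prop) ?_
    intro s hs
    rw [Set.uIcc_of_le ht] at hs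
    linarith [hs.2]
  refine intervalIntegral.norm_integral_le_of_norm_le ht ?_ hbi
  have hne : ∀ᵐ s : ℝ, s ≠ t := by simp [ae_iff]
  filter_upwards [hne] with s hst hs
  have hlt : s < t := lt_of_le_of_ne hs.2 hst
  obtain ⟨g, hg, hKg, hg1⟩ := exists_gaussian_bound (sub_pos.2 hlt) x
  have ha0 : 0 < t - s + 2 * e := by linarith
  have hC : ∀ w, covC n t s x w ^ 2 ≤ (t + 2 * e - s)⁻¹ := by
    intro w
    have h := abs_covC_le n hs.1.le hs.2 x w
    rw [← hedef] at h
    calc covC n t s x w ^ 2 = |covC n t s x w| ^ 2 := (sq_abs _).symm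
      _ ≤ ((t - s + 2 * e) ^ (-(1 : ℝ) / 2)) ^ 2 := by gcongr
      _ = (t + 2 * e - s)⁻¹ := by
        rw [← Real.rpow_natCast, ← Real.rpow_mul ha0.le,
          show -(1 : ℝ) / 2 * ((2 : ℕ) : ℝ) = -1 by norm_num, Real.rpow_neg_one]
        congr 1; ring
  have hinv : 0 ≤ (t + 2 * e - s)⁻¹ := inv_nonneg.2 (by linarith)
  calc ‖∫ w, mehlerK (t - s) x w * covC n t s x w ^ 2‖
      ≤ ∫ w, g w * (t + 2 * e - s)⁻¹ := by
        refine norm_integral_le_of_norm_le (hg.mul_const _) (Filter.Eventually.of_forall ?_)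
        intro w
        have hK := mehlerK_nonneg (sub_pos.2 hlt).le x w
        rw [Real.norm_of_nonneg (mul_nonneg hK (sq_nonneg _))]
        exact mul_le_mul (hKg w) (hC w) (sq_nonneg _) (hK.trans (hKg w))
    _ ≤ 1 * (t + 2 * e - s)⁻¹ := by
        rw [integral_mul_const]
        exact mul_le_mul_of_nonneg_right hg1 hinv
    _ = _ := one_mul _

lemma mehlerK_diag_le {e σ : ℝ} (he : 0 < e) (hσ : e ≤ σ) (x : EuclideanSpace ℝ (Fin 3)) :
    ‖mehlerK (2 * σ) x x‖ ≤ e ^ (-(3 : ℝ) / 2) := by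
  have hσ0 : 0 < 2 * σ := by linarith
  rw [Real.norm_of_nonneg (mehlerK_nonneg hσ0.le x x)]
  exact (mehlerK_le_rpow hσ0 x x).trans
    (Real.rpow_le_rpow_of_nonpos he (by linarith) (by norm_num))

lemma abs_c1_le (n : ℕ) {t : ℝ} (ht : 0 ≤ t) (x : EuclideanSpace ℝ (Fin 3)) :
    |c1 n t x| ≤ ((2 : ℝ) ^ (-(n : ℝ))) ^ (-(3 : ℝ) / 2) * t := by
  have he : 0 < (2 : ℝ) ^ (-(n : ℝ)) := by positivity
  unfold c1
  set e := (2 : ℝ) ^ (-(n : ℝ))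
  have h := intervalIntegral.norm_integral_le_of_norm_le_const (a := e) (b := t + e)
    (f := fun σ => mehlerK (2 * σ) x x) (C := e ^ (-(3 : ℝ) / 2)) (by
      intro σ hσ
      rw [Set.uIoc_of_le (by linarith)] at hσ
      exact mehlerK_diag_le he hσ.1.le x)
  rwa [add_sub_cancel_right, abs_of_nonneg ht] at h

lemma c1_nonneg (n : ℕ) {t : ℝ} (ht : 0 ≤ t) (x : EuclideanSpace ℝ (Fin 3)) : 0 ≤ c1 n t x := by
  have he : 0 < (2 : ℝ) ^ (-(n : ℝ)) := by positivity
  refine intervalIntegral.integral_nonneg (by linarith) fun σ hσ => mehlerK_nonneg ?_ x x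
  linarith [hσ.1]

/-- Short-time lower bound for the Mehler kernel on the diagonal. -/
lemma le_mehlerK_diag {e σ : ℝ} (he : 0 < e) (heσ : e ≤ σ) (hσe : σ ≤ 2 * e) (hσ1 : σ ≤ 1)
    (x : EuclideanSpace ℝ (Fin 3)) :
    (16 * π * Real.exp 4 * e) ^ (-(3 : ℝ) / 2) * Real.exp (-‖x‖ ^ 2) ≤ mehlerK (2 * σ) x x := by
  have hσ0 : 0 < σ := he.trans_le heσ
  have hs0 : 0 < Real.sinh (2 * (2 * σ)) := Real.sinh_pos_iff.2 (by linarith)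
  unfold mehlerK
  refine mul_le_mul ?_ (Real.exp_le_exp.2 ?_) (Real.exp_pos _).le (by positivity)
  · refine Real.rpow_le_rpow_of_nonpos (by positivity) ?_ (by norm_num)
    have h1 := sinh_le_mul_exp (2 * (2 * σ))
    have h2 : Real.exp (2 * (2 * σ)) ≤ Real.exp 4 := Real.exp_le_exp.2 (by linarith)
    have h3 : Real.sinh (2 * (2 * σ)) ≤ 8 * e * Real.exp 4 :=
      h1.trans (mul_le_mul (by linarith) h2 (Real.exp_pos _).le (by linarith))
    nlinarith [Real.pi_pos]
  · have h1 : ‖x + x‖ ^ 2 = 4 * ‖x‖ ^ 2 := by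
      rw [← two_smul ℝ x, norm_smul]; norm_num; ring
    have h2 := (Real.tanh_lt_one (2 * σ)).le
    rw [h1, sub_self, norm_zero]
    have : Real.tanh (2 * σ) * ‖x‖ ^ 2 ≤ 1 * ‖x‖ ^ 2 := by gcongr
    norm_num
    linarith

lemma le_c1 (n : ℕ) (hn : 1 ≤ n) {t : ℝ} (ht : 1 ≤ t) (x : EuclideanSpace ℝ (Fin 3)) :
    (16 * π * Real.exp 4) ^ (-(3 : ℝ) / 2) * ((2 : ℝ) ^ n) ^ ((1 : ℝ) / 2) *
      Real.exp (-‖x‖ ^ 2) ≤ c1 n t x := by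
  have he : 0 < (2 : ℝ) ^ (-(n : ℝ)) := by positivity
  have he2 : (2 : ℝ) ^ (-(n : ℝ)) ≤ 1 / 2 := by
    calc (2 : ℝ) ^ (-(n : ℝ)) ≤ (2 : ℝ) ^ (-(1 : ℝ)) :=
          Real.rpow_le_rpow_of_exponent_le (by norm_num) (by simpa using hn)
      _ = 1 / 2 := by norm_num [Real.rpow_neg_one]
  have hpow : (2 : ℝ) ^ n = ((2 : ℝ) ^ (-(n : ℝ)))⁻¹ := by
    rw [Real.rpow_neg (by norm_num), inv_inv, Real.rpow_natCast]
  rw [hpow]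
  unfold c1
  set e := (2 : ℝ) ^ (-(n : ℝ))
  set M := 16 * π * Real.exp 4 with hM
  have hM0 : 0 < M := by positivity
  have hmeas : Measurable fun σ : ℝ => mehlerK (2 * σ) x x :=
    measurable_mehlerK (by fun_prop) (by fun_prop) (by fun_prop)
  have hii : ∀ b, e ≤ b → IntervalIntegrable (fun σ => mehlerK (2 * σ) x x) volume e b := by
    intro b hb
    refine (intervalIntegrable_const (c := e ^ (-(3 : ℝ) / 2))).mono_fun
      hmeas.aestronglyMeasurable ?_
    filter_upwards [ae_restrict_mem measurableSet_uIoc] with σ hσ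
    rw [Set.uIoc_of_le hb] at hσ
    exact (mehlerK_diag_le he hσ.1.le x).trans (Real.le_norm_self _)
  calc M ^ (-(3 : ℝ) / 2) * (e⁻¹) ^ ((1 : ℝ) / 2) * Real.exp (-‖x‖ ^ 2)
      = ∫ _ in e..2 * e, (M * e) ^ (-(3 : ℝ) / 2) * Real.exp (-‖x‖ ^ 2) := by
        rw [intervalIntegral.integral_const, smul_eq_mul, Real.mul_rpow hM0.le he.le,
          Real.inv_rpow he.le, ← Real.rpow_neg he.le]
        have : e ^ (-((1 : ℝ) / 2)) = e * e ^ (-(3 : ℝ) / 2) := by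
          rw [← Real.rpow_one_add' he.le (by norm_num)]; norm_num
        rw [this]; ring
    _ ≤ ∫ σ in e..2 * e, mehlerK (2 * σ) x x := by
        refine intervalIntegral.integral_mono_on (by linarith) intervalIntegrable_const
          (hii _ (by linarith)) fun σ hσ => ?_
        exact le_mehlerK_diag he hσ.1 hσ.2 (by linarith [hσ.2]) x
    _ ≤ ∫ σ in e..t + e, mehlerK (2 * σ) x x := by
        refine intervalIntegral.integral_mono_interval le_rfl (by linarith) (by linarith) ?_
          (hii _ (by linarith))
        filter_upwards [ae_restrict_mem measurableSet_Ioc] with σ hσ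
        exact mehlerK_nonneg (by linarith [hσ.1]) x x

/-- Square roots dominate logarithms. -/
lemma tendsto_sqrt_sub_log_atTop {A : ℝ} (hA : 0 < A) (B D : ℝ) :
    Filter.Tendsto (fun X : ℝ => A * X ^ ((1 : ℝ) / 2) - B * (D + Real.log X))
      Filter.atTop Filter.atTop := by
  have h1 : Filter.Tendsto (fun X : ℝ => X ^ ((1 : ℝ) / 2)) Filter.atTop Filter.atTop :=
    tendsto_rpow_atTop (by norm_num)
  have h2 : Filter.Tendsto (fun X : ℝ => Real.log X / X ^ ((1 : ℝ) / 2)) Filter.atTop (nhds 0) :=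
    (isLittleO_log_rpow_atTop (by norm_num)).tendsto_div_nhds_zero
  have h3 : Filter.Tendsto (fun X : ℝ => D / X ^ ((1 : ℝ) / 2)) Filter.atTop (nhds 0) :=
    h1.const_div_atTop D
  have h4 : Filter.Tendsto
      (fun X : ℝ => A - B * (D / X ^ ((1 : ℝ) / 2) + Real.log X / X ^ ((1 : ℝ) / 2)))
      Filter.atTop (nhds A) := by
    simpa using tendsto_const_nhds.sub ((h3.add h2).const_mul B)
  refine (h1.atTop_mul_pos hA h4).congr' ?_
  filter_upwards [Filter.eventually_gt_atTop 0] with X hX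
  have : 0 < X ^ ((1 : ℝ) / 2) := by positivity
  field_simp

/-- testing the renormalization function against a nonnegative smooth
compactly supported function `φ ⊗ ψ` with `φ ≡ 1` on `[1,2]` and `ψ ≢ 0` yields a quantity
that diverges to `+∞` as `n → ∞`. -/
theorem cRen_diverges (φ : ℝ → ℝ) (ψ : EuclideanSpace ℝ (Fin 3) → ℝ)
    (hφ0 : ∀ t, 0 ≤ φ t) (hφs : ContDiff ℝ (⊤ : ℕ∞) φ) (hφc : HasCompactSupport φ)
    (hφ1 : ∀ t ∈ Set.Icc (1 : ℝ) 2, φ t = 1)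
    (hψ0 : ∀ x, 0 ≤ ψ x) (hψs : ContDiff ℝ (⊤ : ℕ∞) ψ) (hψc : HasCompactSupport ψ)
    (hψne : ψ ≠ 0) :
    Filter.Tendsto (fun n : ℕ => ∫ t in Set.Ioi (0 : ℝ), ∫ x, φ t * ψ x * cRen n t x)
      Filter.atTop Filter.atTop := by
  obtain ⟨T, hT⟩ : ∃ T : ℝ, ∀ t, T < t → φ t = 0 := by
    obtain ⟨T, hT⟩ := hφc.isCompact.bddAbove
    refine ⟨T, fun t ht => ?_⟩
    by_contra h
    exact absurd (hT (subset_tsupport φ h)) (not_le.2 ht)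
  have hT0 : 0 < T := by
    by_contra h
    have := hφ1 1 (by norm_num)
    rw [hT 1 (by linarith)] at this
    norm_num at this
  set ν : Measure ℝ := volume.restrict (Set.Ioi (0 : ℝ)) with hν
  have hφi : Integrable φ ν := (hφs.continuous.integrable_of_hasCompactSupport hφc).restrict
  have hψi : Integrable ψ := hψs.continuous.integrable_of_hasCompactSupport hψc
  set ρ : EuclideanSpace ℝ (Fin 3) → ℝ := fun x => ψ x * Real.exp (-‖x‖ ^ 2) with hρ
  have hρcont : Continuous ρ := hψs.continuous.mul (by fun_prop)
  have hρc : HasCompactSupport ρ := hψc.mul_right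
  have hρi : Integrable ρ := hρcont.integrable_of_hasCompactSupport hρc
  have hρpos : 0 < ∫ x, ρ x := by
    obtain ⟨x, hx⟩ := Function.ne_iff.1 hψne
    exact hρcont.integral_pos_of_hasCompactSupport_nonneg_nonzero hρc
      (fun y => mul_nonneg (hψ0 y) (Real.exp_pos _).le) (x := x)
      (mul_ne_zero hx (Real.exp_pos _).ne')
  set χ : ℝ → ℝ := (Set.Icc (1 : ℝ) 2).indicator 1 with hχ
  have hχi : Integrable χ ν :=
    ((integrable_indicator_iff measurableSet_Icc).2
      (integrableOn_const (by simp : volume (Set.Icc (1 : ℝ) 2) ≠ ⊤))).restrict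
  have hχ1 : ∫ t, χ t ∂ν = 1 := by
    rw [hχ, integral_indicator_one measurableSet_Icc, hν, measureReal_restrict_apply
      measurableSet_Icc, Set.inter_eq_left.2 (show Set.Icc (1 : ℝ) 2 ⊆ Set.Ioi 0 from
        fun t ht => lt_of_lt_of_le one_pos ht.1)]
    norm_num
  set c : ℝ := (16 * π * Real.exp 4) ^ (-(3 : ℝ) / 2) with hc
  have hc0 : 0 < c := by positivity
  set D : ℝ := Real.log ((T + 2) / 2) with hD
  have hlim := (tendsto_sqrt_sub_log_atTop (A := 3 * c * ∫ x, ρ x) (by positivity)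
    (18 * ((∫ t, φ t ∂ν) * ∫ x, ψ x)) D).comp
    (tendsto_pow_atTop_atTop_of_one_lt (one_lt_two : (1 : ℝ) < 2))
  refine Filter.tendsto_atTop_mono' _ ?_ hlim
  filter_upwards [Filter.eventually_ge_atTop 1] with n hn
  simp only [Function.comp_apply]
  have he : 0 < (2 : ℝ) ^ (-(n : ℝ)) := by positivity
  have hpow : (2 : ℝ) ^ (-(n : ℝ)) = ((2 : ℝ) ^ n)⁻¹ := by
    rw [Real.rpow_neg (by norm_num), Real.rpow_natCast]
  have hX1 : (1 : ℝ) ≤ 2 ^ n := one_le_pow₀ (by norm_num)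
  set L : ℝ := D + Real.log ((2 : ℝ) ^ n) with hL
  have hc2 : ∀ t x, 0 ≤ t → t ≤ T → |c2 n t x| ≤ 2 * L := by
    intro t x ht htT
    refine (abs_c2_le n ht x).trans (mul_le_mul_of_nonneg_left ?_ (by norm_num))
    rw [hL, hD, ← Real.log_mul (by positivity) (by positivity)]
    refine Real.log_le_log (by positivity) ?_
    rw [div_le_iff₀ (by positivity), hpow]
    have : ((2 : ℝ) ^ n)⁻¹ ≤ 1 := inv_le_one_of_one_le₀ hX1
    field_simp at this ⊢
    nlinarith
  set E : ℝ := (2 : ℝ) ^ (-(n : ℝ)) with hE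
  have hpos : ∀ᵐ p : ℝ × EuclideanSpace ℝ (Fin 3) ∂ν.prod volume, 0 < p.1 :=
    Measure.quasiMeasurePreserving_fst.ae (ae_restrict_mem measurableSet_Ioi)
  have hint : Integrable (fun p : ℝ × EuclideanSpace ℝ (Fin 3) => φ p.1 * ψ p.2 * cRen n p.1 p.2)
      (ν.prod volume) := by
    refine ((hφi.mul_prod hψi).mul_const (3 * (E ^ (-(3 : ℝ) / 2) * T) + 9 * (2 * L))).mono'
      (((hφs.continuous.measurable.comp measurable_fst).mul
        (hψs.continuous.measurable.comp measurable_snd)).mul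
          (measurable_cRen n)).aestronglyMeasurable ?_
    filter_upwards [hpos] with p hp
    rcases lt_or_ge T p.1 with h | h
    · simp [hT _ h]
    · rw [norm_mul, Real.norm_of_nonneg (mul_nonneg (hφ0 _) (hψ0 _))]
      refine mul_le_mul_of_nonneg_left ?_ (mul_nonneg (hφ0 _) (hψ0 _))
      have h1 := abs_c1_le n hp.le p.2
      have h2 := hc2 p.1 p.2 hp.le h
      have h3 : E ^ (-(3 : ℝ) / 2) * p.1 ≤ E ^ (-(3 : ℝ) / 2) * T := by gcongr
      rw [Real.norm_eq_abs, cRen]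
      rw [abs_le] at *
      constructor <;> linarith [h1.1, h1.2, h2.1, h2.2]
  rw [← integral_prod _ hint]
  have hlow : ∫ p : ℝ × EuclideanSpace ℝ (Fin 3),
      (3 * c * ((2 : ℝ) ^ n) ^ ((1 : ℝ) / 2) * (χ p.1 * ρ p.2) - 18 * L * (φ p.1 * ψ p.2))
        ∂ν.prod volume =
      3 * c * (∫ x, ρ x) * ((2 : ℝ) ^ n) ^ ((1 : ℝ) / 2) -
        18 * ((∫ t, φ t ∂ν) * ∫ x, ψ x) * L := by
    rw [integral_sub ((hχi.mul_prod hρi).const_mul _) ((hφi.mul_prod hψi).const_mul _),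
      integral_const_mul, integral_const_mul, integral_prod_mul, integral_prod_mul, hχ1]
    ring
  rw [← hlow]
  refine integral_mono_ae
    (((hχi.mul_prod hρi).const_mul _).sub ((hφi.mul_prod hψi).const_mul _)) hint ?_
  filter_upwards [hpos] with p hp
  have hw : 0 ≤ φ p.1 * ψ p.2 := mul_nonneg (hφ0 _) (hψ0 _)
  have hfirst : c * ((2 : ℝ) ^ n) ^ ((1 : ℝ) / 2) * (χ p.1 * ρ p.2) ≤
      φ p.1 * ψ p.2 * c1 n p.1 p.2 := by
    by_cases ht : p.1 ∈ Set.Icc (1 : ℝ) 2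
    · have h := mul_le_mul_of_nonneg_left (le_c1 n hn ht.1 p.2) (hψ0 p.2)
      rw [← hc] at h
      simp only [hχ, hρ, Set.indicator_of_mem ht, hφ1 _ ht, Pi.one_apply]
      linarith
    · rw [hχ, Set.indicator_of_notMem ht, zero_mul, mul_zero]
      exact mul_nonneg hw (c1_nonneg n hp.le _)
  have hsecond : φ p.1 * ψ p.2 * c2 n p.1 p.2 ≤ φ p.1 * ψ p.2 * (2 * L) := by
    rcases lt_or_ge T p.1 with h | h
    · simp [hT _ h]
    · exact mul_le_mul_of_nonneg_left ((le_abs_self _).trans (hc2 _ _ hp.le h)) hw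
  simp only [cRen]
  linarith

end
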